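/- arXiv:2403.11467 — 2 statements merged into one kernel-verified Lean document; each statement's English description precedes it below -/
import Mathlib

section
/- Let 0 < α < Q, 1 < p < Q/α and 1/q = 1/p − α/Q. If ω ∈ A_{p,q}, then there is a constant C such that (∫_{ℍⁿ}[M_α f(z)]^q [ω(z)]^q dz)^{1/q} ≤ C (∫_{ℍⁿ}|f(z)|^p [ω(z)]^p dz)^{1/p} for all f. -/
open MeasureTheory ENNReal Real Set

noncomputable section

namespace Heisenberg

variable (n : ℕ)

/-- The underlying space of the Heisenberg group `ℍⁿ = ℝ^{2n} × ℝ`. -/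
abbrev Hei := (Fin (2*n) → ℝ) × ℝ

variable {n}

/-- Index of the `i`-th coordinate of the first half. -/
def lo (i : Fin n) : Fin (2*n) := Fin.cast (two_mul n).symm (Fin.castAdd n i)

/-- Index of the `i`-th coordinate of the second half. -/
def hi (i : Fin n) : Fin (2*n) := Fin.cast (two_mul n).symm (Fin.natAdd n i)

/-- The bilinear form `xᵀ J y` with `J = (1/2)[[0,−Iₙ],[Iₙ,0]]`. -/
def symp (x y : Fin (2*n) → ℝ) : ℝ :=
  (1/2) * ∑ i : Fin n, (x (hi i) * y (lo i) - x (lo i) * y (hi i))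

/-- The Heisenberg group law `(x,t)·(y,s) = (x+y, t+s+xᵀJy)`. -/
def hmul (z w : Hei n) : Hei n := (z.1 + w.1, z.2 + w.2 + symp z.1 w.1)

/-- Inverse: `(x,t)⁻¹ = (−x,−t)`. -/
def hinv (z : Hei n) : Hei n := (-z.1, -z.2)

/-- The identity element `e = (0,0)`. -/
def he : Hei n := (0, 0)

/-- Anisotropic dilations `r·(x,t) = (rx, r²t)`. -/
def hdil (r : ℝ) (z : Hei n) : Hei n := (r • z.1, r^2 * z.2)

/-- The Koranyi norm `ρ(x,t) = (|x|⁴ + 16 t²)^{1/4}`. -/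
def knorm (z : Hei n) : ℝ := ((∑ i, (z.1 i)^2)^2 + 16 * z.2^2) ^ (1/4 : ℝ)

/-- The `ρ`-ball `B(z₀,δ) = {w : ρ(z₀⁻¹·w) < δ}`. -/
def kball (z₀ : Hei n) (δ : ℝ) : Set (Hei n) := {w | knorm (hmul (hinv z₀) w) < δ}

/-- The homogeneous dimension `Q = 2n+2`. -/
def Q (n : ℕ) : ℝ := 2*n+2

/-! ### Variable Lebesgue spaces -/

/-- The modular `∫ (g(z)/λ)^{p(z)} dz` (for `ℝ≥0∞`-valued `g`). -/
def modular (p : Hei n → ℝ) (g : Hei n → ℝ≥0∞) (lam : ℝ) : ℝ≥0∞ :=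
  ∫⁻ z, (g z / ENNReal.ofReal lam) ^ (p z)

/-- The Luxemburg norm on `L^{p(·)}(ℍⁿ)` for `ℝ≥0∞`-valued functions. -/
def vnormE (p : Hei n → ℝ) (g : Hei n → ℝ≥0∞) : ℝ :=
  sInf {lam : ℝ | 0 < lam ∧ modular p g lam ≤ 1}

/-- The Luxemburg norm `‖f‖_{L^{p(·)}(ℍⁿ)}`. -/
def vnorm (p : Hei n → ℝ) (f : Hei n → ℝ) : ℝ :=
  vnormE p (fun z => ENNReal.ofReal |f z|)

/-- Membership in the variable Lebesgue space (`ℝ≥0∞`-valued version). -/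
def MemVLpE (p : Hei n → ℝ) (g : Hei n → ℝ≥0∞) : Prop :=
  ∃ lam : ℝ, 0 < lam ∧ modular p g lam < ⊤

/-- Membership in `L^{p(·)}(ℍⁿ)`. -/
def MemVLp (p : Hei n → ℝ) (f : Hei n → ℝ) : Prop :=
  MemVLpE p (fun z => ENNReal.ofReal |f z|)

/-- The characteristic function of a set, `ℝ≥0∞`-valued. -/
def chiE (B : Set (Hei n)) : Hei n → ℝ≥0∞ := B.indicator fun _ => 1

/-- `‖χ_B‖_{L^{p(·)}}`. -/
def chiNorm (p : Hei n → ℝ) (B : Set (Hei n)) : ℝ := vnormE p (chiE B)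

/-- `p₋`, the essential infimum of the exponent. -/
def pminus (p : Hei n → ℝ) : ℝ := essInf p volume

/-- `p₊`, the essential supremum of the exponent. -/
def pplus (p : Hei n → ℝ) : ℝ := essSup p volume

/-- `p̲ = min{p₋, 1}`. -/
def punder (p : Hei n → ℝ) : ℝ := min (pminus p) 1

/-- The conjugate exponent `p′ = p/(p−1)`. -/
def conjExp (a : ℝ) : ℝ := a / (a - 1)

/-- Local log-Hölder continuity: `|p(z)−p(w)| ≤ C/(−log ρ(z⁻¹w))` for `ρ(z⁻¹w) ≤ 1/2`. -/
def LogHolderLocal (p : Hei n → ℝ) : Prop :=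
  ∃ C > 0, ∀ z w : Hei n, knorm (hmul (hinv z) w) ≤ 1/2 →
    |p z - p w| * (-Real.log (knorm (hmul (hinv z) w))) ≤ C

/-- log-Hölder decay at infinity: `|p(z) − p_∞| ≤ C_∞/log(e+ρ(z))`. -/
def LogDecay (p : Hei n → ℝ) (pinf : ℝ) : Prop :=
  ∃ C > 0, ∀ z : Hei n, |p z - pinf| * Real.log (Real.exp 1 + knorm z) ≤ C

/-- The class `P^{log}(ℍⁿ)`: measurable exponents with `0 < p₋ ≤ p₊ < ∞` satisfying both
log-Hölder conditions. -/
def IsPLog (p : Hei n → ℝ) : Prop :=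
  Measurable p ∧ 0 < pminus p ∧ (∃ M : ℝ, ∀ᵐ z ∂(volume : Measure (Hei n)), p z ≤ M) ∧
    LogHolderLocal p ∧ ∃ pinf : ℝ, LogDecay p pinf

/-! ### Maximal operators and weights -/

/-- The fractional maximal operator `M_α f(z) = sup_{B ∋ z} |B|^{α/Q−1} ∫_B |f|`
(`α = 0` gives the Hardy–Littlewood maximal operator). -/
def fracMax (α : ℝ) (f : Hei n → ℝ) (z : Hei n) : ℝ≥0∞ :=
  ⨆ (z₀ : Hei n) (δ : ℝ) (_ : 0 < δ) (_ : z ∈ kball z₀ δ),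
    volume (kball z₀ δ) ^ (α / Q n - 1) * ∫⁻ w in kball z₀ δ, ENNReal.ofReal |f w|

/-- A weight: positive a.e. and locally integrable. -/
def IsWeight (ω : Hei n → ℝ) : Prop :=
  Measurable ω ∧ (∀ᵐ z ∂(volume : Measure (Hei n)), 0 < ω z) ∧ LocallyIntegrable ω volume

/-- `ω(E) = ∫_E ω`. -/
def wInt (ω : Hei n → ℝ) (B : Set (Hei n)) : ℝ≥0∞ := ∫⁻ z in B, ENNReal.ofReal (ω z)

/-- The Muckenhoupt class `A₁`: `Mω ≤ C ω` a.e. -/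
def IsA1 (ω : Hei n → ℝ) : Prop :=
  IsWeight ω ∧ ∃ C > 0, ∀ᵐ z ∂(volume : Measure (Hei n)),
    fracMax 0 ω z ≤ ENNReal.ofReal (C * ω z)

/-- The Muckenhoupt class `A_p`, `p > 1`. -/
def IsAp (p : ℝ) (ω : Hei n → ℝ) : Prop :=
  IsWeight ω ∧ ∃ C > 0, ∀ (z₀ : Hei n) (δ : ℝ), 0 < δ →
    wInt ω (kball z₀ δ) * wInt (fun z => ω z ^ (-(1/(p-1)))) (kball z₀ δ) ^ (p-1)
      ≤ ENNReal.ofReal C * volume (kball z₀ δ) ^ p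

/-- Membership in `A_s` for `s ≥ 1` (`A₁` when `s = 1`). -/
def MemA (s : ℝ) (ω : Hei n → ℝ) : Prop :=
  (s = 1 ∧ IsA1 ω) ∨ (1 < s ∧ IsAp s ω)

/-- The reverse doubling condition (RD). -/
def ReverseDoubling (ω : Hei n → ℝ) : Prop :=
  ∃ a ∈ Ioo (0:ℝ) 1, ∃ b ∈ Ioo (0:ℝ) 1, ∀ (z : Hei n) (δ₁ δ₂ : ℝ), 0 < δ₁ → δ₁ < δ₂ →
    volume (kball z δ₁) ≤ ENNReal.ofReal a * volume (kball z δ₂) →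
    wInt ω (kball z δ₁) ≤ ENNReal.ofReal b * wInt ω (kball z δ₂)

/-- The class `A_{p,q}` of weights, `1 < p ≤ q < ∞`. -/
def IsApq (p q : ℝ) (ω : Hei n → ℝ) : Prop :=
  IsWeight ω ∧ ∃ C > 0, ∀ (z₀ : Hei n) (δ : ℝ), 0 < δ →
    wInt (fun z => ω z ^ q) (kball z₀ δ) ^ (1/q) *
      wInt (fun z => ω z ^ (-conjExp p)) (kball z₀ δ) ^ (1/conjExp p)
      ≤ ENNReal.ofReal C * volume (kball z₀ δ) ^ (1/q + 1/conjExp p)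

/-! ### Invariant derivatives, Schwartz seminorms, Hardy spaces -/

/-- The element of `ℍⁿ` with the value `s` in the `i`-th coordinate and `0` elsewhere. -/
def coordVec (i : Fin (2*n+1)) (s : ℝ) : Hei n :=
  if h : (i : ℕ) < 2*n then (fun j => if j = ⟨i, h⟩ then s else 0, 0) else (0, s)

/-- Left-invariant vector field: `(X_i f)(z) = d/ds f(z · s e_i)|_{s=0}`. -/
def XDeriv (i : Fin (2*n+1)) (f : Hei n → ℝ) (z : Hei n) : ℝ :=
  deriv (fun s : ℝ => f (hmul z (coordVec i s))) 0

/-- Right-invariant vector field: `(X̃_i f)(z) = d/ds f(s e_i · z)|_{s=0}`. -/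
def XtDeriv (i : Fin (2*n+1)) (f : Hei n → ℝ) (z : Hei n) : ℝ :=
  deriv (fun s : ℝ => f (hmul (coordVec i s) z)) 0

/-- Higher-order left-invariant derivative `X^I = X₁^{i₁} ⋯ X_{2n+1}^{i_{2n+1}}`. -/
def XI (I : Fin (2*n+1) → ℕ) : (Hei n → ℝ) → (Hei n → ℝ) :=
  ((List.finRange (2*n+1)).map fun i => (XDeriv i)^[I i]).foldr (· ∘ ·) id

/-- Higher-order right-invariant derivative `X̃^I`. -/
def XtI (I : Fin (2*n+1) → ℕ) : (Hei n → ℝ) → (Hei n → ℝ) :=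
  ((List.finRange (2*n+1)).map fun i => (XtDeriv i)^[I i]).foldr (· ∘ ·) id

/-- The homogeneous degree `d(I) = i₁ + ⋯ + i_{2n} + 2 i_{2n+1}`. -/
def homDeg (I : Fin (2*n+1) → ℕ) : ℕ :=
  (∑ i : Fin (2*n), I (Fin.castSucc i)) + 2 * I (Fin.last (2*n))

/-- The monomial `z^I = x₁^{i₁} ⋯ x_{2n}^{i_{2n}} t^{i_{2n+1}}`. -/
def monomial (I : Fin (2*n+1) → ℕ) (z : Hei n) : ℝ :=
  (∏ i : Fin (2*n), z.1 i ^ I (Fin.castSucc i)) * z.2 ^ I (Fin.last (2*n))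

/-- The Schwartz seminorm `‖φ‖_{S,L} = Σ_{d(I) ≤ L} sup_z (1+ρ(z))^{(L+1)(Q+1)} |X^I φ(z)|`. -/
def schwartzSemi (L : ℕ) (φ : Hei n → ℝ) : ℝ :=
  ∑ I : Fin (2*n+1) → Fin (L+1),
    if homDeg (fun i => (I i : ℕ)) ≤ L then
      ⨆ z : Hei n, (1 + knorm z) ^ ((L+1)*(2*n+3)) * |XI (fun i => (I i : ℕ)) φ z|
    else 0

/-- Schwartz functions on `ℍⁿ`. -/
def IsSchwartz (φ : Hei n → ℝ) : Prop :=
  ContDiff ℝ (⊤ : ℕ∞) φ ∧ ∀ (L : ℕ) (I : Fin (2*n+1) → ℕ), ∃ C : ℝ, ∀ z,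
    (1 + knorm z) ^ L * |XI I φ z| ≤ C

/-- Convolution `(f ∗ g)(z) = ∫ f(w) g(w⁻¹·z) dw`. -/
def conv (f g : Hei n → ℝ) (z : Hei n) : ℝ := ∫ w, f w * g (hmul (hinv w) z)

/-- The dilate `φ_t(z) = t^{−Q} φ(t⁻¹·z)`. -/
def dilPhi (t : ℝ) (φ : Hei n → ℝ) (z : Hei n) : ℝ := t ^ (-(Q n)) * φ (hdil t⁻¹ z)

/-- The grand maximal function `M_L f(z) = sup_{t>0} sup_{‖φ‖_{S,L} ≤ 1} |(f∗φ_t)(z)|`. -/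
def grandMax (L : ℕ) (f : Hei n → ℝ) (z : Hei n) : ℝ≥0∞ :=
  ⨆ (t : ℝ) (_ : 0 < t) (φ : Hei n → ℝ) (_ : IsSchwartz φ) (_ : schwartzSemi L φ ≤ 1),
    ENNReal.ofReal |conv f (dilPhi t φ) z|

/-- `D_{p(·)} = min{k ≥ 0 : (2n+k+3) p₋ > 2n+2}`. -/
def Dexp (p : Hei n → ℝ) : ℕ :=
  sInf {k : ℕ | (2*(n:ℝ)+2) < (2*(n:ℝ)+(k:ℝ)+3) * pminus p}

/-- The order `L = D_{p(·)} + Q + 3` of the grand maximal function defining `H^{p(·)}`. -/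
def hardyIndex (p : Hei n → ℝ) : ℕ := Dexp p + (2*n+2) + 3

/-- The Hardy norm `‖f‖_{H^{p(·)}} = ‖M_L f‖_{L^{p(·)}}`. -/
def hnorm (p : Hei n → ℝ) (f : Hei n → ℝ) : ℝ := vnormE p (grandMax (hardyIndex p) f)

/-- Membership in the variable Hardy space `H^{p(·)}(ℍⁿ)`. -/
def MemHardy (p : Hei n → ℝ) (f : Hei n → ℝ) : Prop :=
  MemVLpE p (grandMax (hardyIndex p) f)

/-- A `(p(·), p₀, D)`-atom supported in the ball `B(z₀, δ)`. -/
structure IsAtom (p : Hei n → ℝ) (p₀ : ℝ) (D : ℕ) (a : Hei n → ℝ) (z₀ : Hei n) (δ : ℝ) :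
    Prop where
  meas : Measurable a
  supp : ∀ z, z ∉ kball z₀ δ → a z = 0
  size : eLpNorm a (ENNReal.ofReal p₀) volume ≤
    volume (kball z₀ δ) ^ (1/p₀) / ENNReal.ofReal (chiNorm p (kball z₀ δ))
  vanish : ∀ I : Fin (2*n+1) → ℕ, homDeg I ≤ D → ∫ z, a z * monomial I z = 0

/-- The bounded intersection property for a family of sets. -/
def BoundedIntersection (B : ℕ → Set (Hei n)) : Prop :=
  ∃ K : ℕ, ∀ (z : Hei n) (s : Finset ℕ), (∀ j ∈ s, z ∈ B j) → s.card ≤ K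

/-- The quantity `A({λ_j},{B_j},p(·))` with `B_j = B(c_j, d_j)`. -/
def Acal (p : Hei n → ℝ) (lam : ℕ → ℝ) (c : ℕ → Hei n) (d : ℕ → ℝ) : ℝ :=
  vnormE p (fun z => (∑' j,
    ((ENNReal.ofReal (lam j) / ENNReal.ofReal (chiNorm p (kball (c j) (d j)))) *
      chiE (kball (c j) (d j)) z) ^ punder p) ^ (1 / punder p))

/-- Size and smoothness bounds of a kernel of type `(α, N)`:
`C^N` off the origin and `|X̃^I K(z)| ≲ ρ(z)^{α−Q−d(I)}` for `d(I) ≤ N`. -/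
def KernelBounds (α : ℝ) (N : ℕ) (K : Hei n → ℝ) : Prop :=
  ContDiffOn ℝ N K {z : Hei n | z ≠ he} ∧
  ∃ C > 0, ∀ I : Fin (2*n+1) → ℕ, homDeg I ≤ N → ∀ z : Hei n, z ≠ he →
    |XtI I K z| ≤ C * knorm z ^ (α - Q n - homDeg I)

/-- A kernel of type `(α, N)`; for `α = 0` one additionally requires the `L²` bound
`‖f ∗ K‖₂ ≲ ‖f‖₂` for Schwartz functions `f`. -/
def KernelType (α : ℝ) (N : ℕ) (K : Hei n → ℝ) : Prop :=
  KernelBounds α N K ∧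
  (α = 0 → ∃ C > 0, ∀ f : Hei n → ℝ, IsSchwartz f →
    eLpNorm (conv f K) 2 volume ≤ ENNReal.ofReal C * eLpNorm f 2 volume)

section Geometry

lemma knorm_nonneg (z : Hei n) : 0 ≤ knorm z := by unfold knorm; positivity

lemma knorm_pow_four (z : Hei n) : knorm z ^ 4 = (∑ i, (z.1 i)^2)^2 + 16 * z.2^2 := by
  unfold knorm
  rw [← Real.rpow_natCast, ← Real.rpow_mul (by positivity)]
  norm_num

lemma continuous_knorm : Continuous (knorm : Hei n → ℝ) := by
  unfold knorm
  exact Continuous.rpow_const (by fun_prop) (fun _ => Or.inr (by norm_num))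

lemma continuous_symp : Continuous fun v : (Fin (2*n) → ℝ) × (Fin (2*n) → ℝ) =>
    symp v.1 v.2 := by
  unfold symp
  fun_prop

lemma continuous_hmul_left (z : Hei n) : Continuous (hmul z) := by
  have : Continuous fun w : Hei n => symp z.1 w.1 :=
    continuous_symp.comp (continuous_const.prodMk continuous_fst)
  unfold hmul
  fun_prop

lemma sum_lo_add_sum_hi (g : Fin (2*n) → ℝ) :
    ∑ i, g i = ∑ i : Fin n, g (lo i) + ∑ i : Fin n, g (hi i) := by
  rw [← (finCongr (two_mul n).symm).sum_comp g, Fin.sum_univ_add]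
  rfl

lemma four_mul_symp_sq_le (x y : Fin (2*n) → ℝ) :
    4 * symp x y ^ 2 ≤ (∑ i, x i ^ 2) * ∑ i, y i ^ 2 := by
  have h : 2 * symp x y = ∑ i : Fin n ⊕ Fin n,
      Sum.elim (fun i => x (hi i)) (fun i => - x (lo i)) i *
        Sum.elim (fun i => y (lo i)) (fun i => y (hi i)) i := by
    simp only [symp, Fintype.sum_sum_type, Sum.elim_inl, Sum.elim_inr, Finset.sum_sub_distrib,
      neg_mul, Finset.sum_neg_distrib]
    ring
  have hcs := Finset.sum_mul_sq_le_sq_mul_sq Finset.univ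
    (Sum.elim (fun i : Fin n => x (hi i)) (fun i : Fin n => - x (lo i)))
    (Sum.elim (fun i => y (lo i)) (fun i => y (hi i)))
  rw [← h] at hcs
  simp only [Fintype.sum_sum_type, Sum.elim_inl, Sum.elim_inr, neg_sq] at hcs
  rw [sum_lo_add_sum_hi (fun i => x i ^ 2), sum_lo_add_sum_hi (fun i => y i ^ 2)]
  linarith

lemma symp_add_left (x y z : Fin (2*n) → ℝ) : symp (x + y) z = symp x z + symp y z := by
  simp only [symp, Pi.add_apply, ← mul_add, ← Finset.sum_add_distrib]
  congr 1
  refine Finset.sum_congr rfl fun i _ => by ring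

lemma symp_add_right (x y z : Fin (2*n) → ℝ) : symp x (y + z) = symp x y + symp x z := by
  simp only [symp, Pi.add_apply, ← mul_add, ← Finset.sum_add_distrib]
  congr 1
  refine Finset.sum_congr rfl fun i _ => by ring

lemma symp_neg_left (x y : Fin (2*n) → ℝ) : symp (-x) y = -symp x y := by
  simp only [symp, Pi.neg_apply, ← mul_neg, ← Finset.sum_neg_distrib]
  congr 1
  refine Finset.sum_congr rfl fun i _ => by ring

lemma symp_self (x : Fin (2*n) → ℝ) : symp x x = 0 := by
  simp only [symp]
  rw [Finset.sum_eq_zero fun i _ => by ring, mul_zero]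

lemma symp_swap (x y : Fin (2*n) → ℝ) : symp x y = -symp y x := by
  simp only [symp, ← mul_neg, ← Finset.sum_neg_distrib]
  congr 1
  refine Finset.sum_congr rfl fun i _ => by ring

lemma knorm_hmul_le (z w : Hei n) : knorm (hmul z w) ≤ 2 * (knorm z + knorm w) := by
  set a := knorm z with ha
  set b := knorm w with hb
  have a0 : 0 ≤ a := knorm_nonneg z
  have b0 : 0 ≤ b := knorm_nonneg w
  have h1 := knorm_pow_four z
  have h2 := knorm_pow_four w
  rw [← ha] at h1
  rw [← hb] at h2
  set X := ∑ i, (z.1 i)^2 with hX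
  set Y := ∑ i, (w.1 i)^2 with hY
  have X0 : 0 ≤ X := by positivity
  have Y0 : 0 ≤ Y := by positivity
  have hXa : X ≤ a ^ 2 := by
    apply le_of_sq_le_sq _ (by positivity); nlinarith [sq_nonneg z.2]
  have hYb : Y ≤ b ^ 2 := by
    apply le_of_sq_le_sq _ (by positivity); nlinarith [sq_nonneg w.2]
  have hs := four_mul_symp_sq_le z.1 w.1
  have hsum : ∑ i, (z.1 i + w.1 i) ^ 2 ≤ 2 * X + 2 * Y := by
    rw [hX, hY, Finset.mul_sum, Finset.mul_sum, ← Finset.sum_add_distrib]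
    exact Finset.sum_le_sum fun i _ => by nlinarith [sq_nonneg (z.1 i - w.1 i)]
  have hsum0 : 0 ≤ ∑ i, (z.1 i + w.1 i) ^ 2 := by positivity
  refine le_of_pow_le_pow_left₀ (n := 4) (by norm_num) (by positivity) ?_
  rw [knorm_pow_four]
  simp only [hmul, Pi.add_apply]
  set s := symp z.1 w.1
  have e1 : (∑ i, (z.1 i + w.1 i) ^ 2) ^ 2 ≤ (2 * a ^ 2 + 2 * b ^ 2) ^ 2 := by
    gcongr; linarith
  have e2 : (z.2 + w.2 + s) ^ 2 ≤ 3 * (z.2 ^ 2 + w.2 ^ 2 + s ^ 2) := by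
    nlinarith [sq_nonneg (z.2 - w.2), sq_nonneg (z.2 - s), sq_nonneg (w.2 - s)]
  have e3 : 4 * s ^ 2 ≤ a ^ 2 * b ^ 2 := hs.trans (by gcongr)
  have e4 : 16 * z.2 ^ 2 ≤ a ^ 4 := by nlinarith [sq_nonneg X]
  have e5 : 16 * w.2 ^ 2 ≤ b ^ 4 := by nlinarith [sq_nonneg Y]
  have e6 : (2 * (a + b)) ^ 4 = 16 * (a^4 + b^4 + 6 * a^2 * b^2) + 64 * (a^3 * b + a * b^3) := by
    ring
  have e7 : 0 ≤ a^3 * b + a * b^3 := by positivity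
  have e9 : 0 ≤ a^4 := by positivity
  have e10 : 0 ≤ b^4 := by positivity
  nlinarith

lemma knorm_hinv_hmul_comm (z w : Hei n) :
    knorm (hmul (hinv z) w) = knorm (hmul (hinv w) z) := by
  have : hmul (hinv w) z = hinv (hmul (hinv z) w) := by
    simp only [hmul, hinv, Prod.mk.injEq]
    refine ⟨by abel, ?_⟩
    rw [symp_neg_left, symp_neg_left, symp_swap w.1]
    ring
  rw [this]
  simp [knorm, hinv]

lemma knorm_hinv_hmul_self (z : Hei n) : knorm (hmul (hinv z) z) = 0 := by
  simp [hmul, hinv, knorm, symp_neg_left, symp_self]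

lemma knorm_hinv_hmul_triangle (x y z : Hei n) :
    knorm (hmul (hinv x) z) ≤ 2 * (knorm (hmul (hinv x) y) + knorm (hmul (hinv y) z)) := by
  have : hmul (hinv x) z = hmul (hmul (hinv x) y) (hmul (hinv y) z) := by
    simp only [hmul, hinv, Prod.mk.injEq]
    refine ⟨by abel, ?_⟩
    have hy : symp y.1 (-y.1) = 0 := by rw [symp_swap, symp_neg_left, symp_self]; simp
    simp only [symp_add_left, symp_add_right, symp_neg_left, hy]
    rw [symp_swap x.1 (-y.1), symp_neg_left, symp_swap x.1 y.1]
    ring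
  rw [this]
  exact knorm_hmul_le _ _

lemma isOpen_kball (z : Hei n) (δ : ℝ) : IsOpen (kball z δ) :=
  isOpen_lt (continuous_knorm.comp (continuous_hmul_left _)) continuous_const

lemma mem_kball_self (z : Hei n) {δ : ℝ} (hδ : 0 < δ) : z ∈ kball z δ := by
  simpa [kball, knorm_hinv_hmul_self] using hδ

lemma kball_subset_of_inter {a b : Hei n} {r s : ℝ} (h : (kball a r ∩ kball b s).Nonempty)
    (hrs : r ≤ 2 * s) : kball a r ⊆ kball b (16 * s) := by
  obtain ⟨c, hca, hcb⟩ := h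
  intro w hw
  simp only [kball, mem_ofPred_eq] at *
  have h1 := knorm_hinv_hmul_triangle b a w
  have h2 := knorm_hinv_hmul_triangle b c a
  rw [knorm_hinv_hmul_comm c a] at h2
  linarith

end Geometry

section Volume

lemma measurePreserving_hmul_left (z : Hei n) : MeasurePreserving (hmul z) volume volume := by
  have h := MeasurePreserving.skew_product (μa := (volume : Measure (Fin (2*n) → ℝ)))
    (μc := (volume : Measure ℝ)) (μd := (volume : Measure ℝ))
    (measurePreserving_add_left volume z.1)
    (g := fun x t => (z.2 + symp z.1 x) + t) (by
      have := (continuous_hmul_left z).snd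
      simp only [hmul] at this
      refine (this.congr fun v => ?_).measurable
      simp only [Function.uncurry]
      ring)
    (Filter.Eventually.of_forall fun x =>
      (measurePreserving_add_left volume (z.2 + symp z.1 x)).map_eq)
  have e : hmul z = fun p : Hei n => (z.1 + p.1, z.2 + symp z.1 p.1 + p.2) := by
    funext w
    simp only [hmul, Prod.mk.injEq, true_and]
    ring
  rw [e]
  exact h

lemma volume_kball_eq (z : Hei n) (δ : ℝ) :
    volume (kball z δ) = volume (kball (he : Hei n) δ) := by
  have h := (measurePreserving_hmul_left (hinv z)).measure_preimage
    (isOpen_kball he δ).measurableSet.nullMeasurableSet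
  rw [← h]
  congr 1
  ext w
  have : hmul (hinv he) (hmul (hinv z) w) = hmul (hinv z) w := by
    simp [hmul, hinv, he, symp]
  simp [kball, this]

lemma knorm_hdil {r : ℝ} (hr : 0 ≤ r) (z : Hei n) : knorm (hdil r z) = r * knorm z := by
  refine (pow_left_inj₀ (knorm_nonneg _) (mul_nonneg hr (knorm_nonneg _))
    (by norm_num : 4 ≠ 0)).1 ?_
  rw [mul_pow, knorm_pow_four, knorm_pow_four]
  simp only [hdil, Pi.smul_apply, smul_eq_mul, mul_pow, ← Finset.mul_sum]
  ring

lemma exists_volume_hdil_preimage {r : ℝ} (hr : 0 < r) : ∃ c : ℝ≥0∞, c ≠ ∞ ∧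
    ∀ A : Set (Hei n), MeasurableSet A → volume (hdil r ⁻¹' A) = c * volume A := by
  have h1 := Measure.map_addHaar_smul (volume : Measure (Fin (2*n) → ℝ)) hr.ne'
  have h2 := Measure.map_addHaar_smul (volume : Measure ℝ) (pow_pos hr 2).ne'
  refine ⟨ENNReal.ofReal |(r ^ Module.finrank ℝ (Fin (2*n) → ℝ))⁻¹| *
    ENNReal.ofReal |((r ^ 2) ^ Module.finrank ℝ ℝ)⁻¹|,
    mul_ne_top ofReal_ne_top ofReal_ne_top, fun A hA => ?_⟩
  have hm1 : Measurable fun x : Fin (2*n) → ℝ => r • x := measurable_const_smul r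
  have hm2 : Measurable fun x : ℝ => r ^ 2 • x := measurable_const_smul (r ^ 2)
  have h3 := Measure.map_prod_map (volume : Measure (Fin (2*n) → ℝ)) (volume : Measure ℝ) hm1 hm2
  rw [h1, h2, Measure.prod_smul_left, Measure.prod_smul_right, smul_smul] at h3
  have h4 := DFunLike.congr_fun h3 A
  rw [Measure.map_apply (hm1.prodMap hm2) hA] at h4
  exact h4.symm

lemma hdil_preimage_kball {r : ℝ} (hr : 0 < r) (δ : ℝ) :
    hdil r ⁻¹' kball (he : Hei n) (r * δ) = kball he δ := by
  have h (w : Hei n) : hmul (hinv he) w = w := by simp [hmul, hinv, he, symp]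
  ext w
  simp only [kball, mem_preimage, mem_ofPred_eq, h, knorm_hdil hr.le]
  exact mul_lt_mul_iff_right₀ hr

lemma volume_kball_pos (z : Hei n) {δ : ℝ} (hδ : 0 < δ) : 0 < volume (kball z δ) :=
  (isOpen_kball z δ).measure_pos volume ⟨z, mem_kball_self z hδ⟩

lemma isBounded_kball_he (δ : ℝ) : Bornology.IsBounded (kball (he : Hei n) δ) := by
  rcases le_or_gt δ 0 with hδ | hδ
  · convert Bornology.isBounded_empty
    ext w
    simpa [kball] using hδ.trans (knorm_nonneg _)
  refine (Metric.isBounded_iff_subset_closedBall 0).2 ⟨δ + δ ^ 2, fun w hw => ?_⟩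
  have h : hmul (hinv he) w = w := by simp [hmul, hinv, he, symp]
  simp only [kball, mem_ofPred_eq, h] at hw
  have h4 := knorm_pow_four w
  have h5 : knorm w ^ 4 ≤ δ ^ 4 := pow_le_pow_left₀ (knorm_nonneg w) hw.le 4
  have hX : 0 ≤ ∑ i, (w.1 i)^2 := by positivity
  have h6 : ∑ i, (w.1 i)^2 ≤ δ ^ 2 := by
    apply le_of_sq_le_sq _ (by positivity); nlinarith [sq_nonneg w.2]
  rw [mem_closedBall_zero_iff, Prod.norm_def]
  refine max_le ?_ ?_
  · refine (pi_norm_le_iff_of_nonneg (by positivity)).2 fun i => ?_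
    have h7 : (w.1 i)^2 ≤ ∑ i, (w.1 i)^2 :=
      Finset.single_le_sum (f := fun i => (w.1 i)^2) (fun i _ => sq_nonneg _) (Finset.mem_univ i)
    have : |w.1 i| ≤ δ := abs_le_of_sq_le_sq (h7.trans h6) hδ.le
    rw [Real.norm_eq_abs]; nlinarith
  · have : |w.2| ≤ δ ^ 2 := abs_le_of_sq_le_sq (by nlinarith) (by positivity)
    rw [Real.norm_eq_abs]; linarith

lemma volume_kball_lt_top (z : Hei n) (δ : ℝ) : volume (kball z δ) < ∞ := by
  rw [volume_kball_eq]
  exact (isBounded_kball_he δ).measure_lt_top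

variable (n) in
lemma exists_volume_kball_le : ∃ D : ℝ≥0∞, D ≠ ∞ ∧
    ∀ (z : Hei n) (δ : ℝ), volume (kball z (16 * δ)) ≤ D * volume (kball z δ) := by
  obtain ⟨c, hc, h⟩ := exists_volume_hdil_preimage (n := n) (r := 1/16) (by norm_num)
  refine ⟨c, hc, fun z δ => ?_⟩
  rw [volume_kball_eq, volume_kball_eq z, ← h _ (isOpen_kball _ _).measurableSet,
    ← hdil_preimage_kball (r := 1/16) (by norm_num) (16 * δ)]
  norm_num [← mul_assoc]

end Volume

section MaximalFunction

/-- Measures that are positive, finite and doubling on `ρ`-balls. -/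
structure BallDoubling (μ : Measure (Hei n)) (D : ℝ≥0∞) : Prop where
  ne_top : D ≠ ∞
  pos : ∀ (z : Hei n) (δ : ℝ), 0 < δ → μ (kball z δ) ≠ 0
  finite : ∀ (z : Hei n) (δ : ℝ), 0 < δ → μ (kball z δ) ≠ ∞
  doubling : ∀ (z : Hei n) (δ : ℝ), 0 < δ → μ (kball z (16 * δ)) ≤ D * μ (kball z δ)

/-- The uncentred Hardy–Littlewood maximal function with respect to the measure `μ`. -/
def ballMax (μ : Measure (Hei n)) (g : Hei n → ℝ≥0∞) (z : Hei n) : ℝ≥0∞ :=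
  ⨆ (z₀ : Hei n) (δ : ℝ) (_ : 0 < δ) (_ : z ∈ kball z₀ δ),
    (∫⁻ w in kball z₀ δ, g w ∂μ) / μ (kball z₀ δ)

variable {μ : Measure (Hei n)} {D : ℝ≥0∞} {g : Hei n → ℝ≥0∞}

lemma le_ballMax {z z₀ : Hei n} {δ : ℝ} (hδ : 0 < δ) (hz : z ∈ kball z₀ δ) :
    (∫⁻ w in kball z₀ δ, g w ∂μ) / μ (kball z₀ δ) ≤ ballMax μ g z :=
  le_iSup₂_of_le z₀ δ <| le_iSup₂_of_le hδ hz le_rfl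

lemma lt_ballMax_iff {t : ℝ≥0∞} {z : Hei n} : t < ballMax μ g z ↔
    ∃ z₀ δ, 0 < δ ∧ z ∈ kball z₀ δ ∧ t < (∫⁻ w in kball z₀ δ, g w ∂μ) / μ (kball z₀ δ) := by
  simp only [ballMax, lt_iSup_iff, exists_prop]

lemma setOf_lt_ballMax (t : ℝ≥0∞) : {z | t < ballMax μ g z} =
    ⋃ b ∈ {b : Hei n × ℝ | 0 < b.2 ∧
      t < (∫⁻ w in kball b.1 b.2, g w ∂μ) / μ (kball b.1 b.2)}, kball b.1 b.2 := by
  ext z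
  simp only [mem_ofPred_eq, lt_ballMax_iff, mem_iUnion, exists_prop]
  exact ⟨fun ⟨a, d, h1, h2, h3⟩ => ⟨(a, d), ⟨h1, h3⟩, h2⟩,
    fun ⟨b, ⟨h1, h3⟩, h2⟩ => ⟨b.1, b.2, h1, h2, h3⟩⟩

lemma measurable_ballMax : Measurable (ballMax μ g) := by
  refine measurable_of_Ioi fun t => ?_
  change MeasurableSet {z | t < ballMax μ g z}
  rw [setOf_lt_ballMax]
  exact (isOpen_biUnion fun b _ => isOpen_kball _ _).measurableSet

lemma BallDoubling.measure_biUnion_le (hμ : BallDoubling μ D) {t : ℝ≥0∞}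
    (T : Set (Hei n × ℝ)) (R : ℝ) (hR : ∀ b ∈ T, b.2 ≤ R) (hpos : ∀ b ∈ T, 0 < b.2)
    (hT : ∀ b ∈ T, t < (∫⁻ w in kball b.1 b.2, g w ∂μ) / μ (kball b.1 b.2)) :
    t * μ (⋃ b ∈ T, kball b.1 b.2) ≤ D * ∫⁻ w, g w ∂μ := by
  obtain ⟨u, huT, hdisj, hcov⟩ := Vitali.exists_disjoint_subfamily_covering_enlargement
    (fun b : Hei n × ℝ => kball b.1 b.2) T (fun b => b.2) 2 (by norm_num)
    (fun b hb => (hpos b hb).le) R hR (fun b hb => ⟨b.1, mem_kball_self _ (hpos b hb)⟩)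
  have hcount : u.Countable := hdisj.countable_of_isOpen (fun b _ => isOpen_kball _ _)
    (fun b hb => ⟨b.1, mem_kball_self _ (hpos b (huT hb))⟩)
  have hsub : (⋃ b ∈ T, kball b.1 b.2) ⊆ ⋃ b ∈ u, kball b.1 (16 * b.2) := by
    refine iUnion₂_subset fun a ha => ?_
    obtain ⟨b, hb, hab, hle⟩ := hcov a ha
    exact (kball_subset_of_inter hab hle).trans (subset_biUnion_of_mem (u := fun b : Hei n × ℝ =>
      kball b.1 (16 * b.2)) hb)
  have := hcount.to_subtype
  calc t * μ (⋃ b ∈ T, kball b.1 b.2)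
      ≤ t * ∑' b : u, μ (kball b.1.1 (16 * b.1.2)) := by
        gcongr
        exact (measure_mono hsub).trans (MeasureTheory.measure_biUnion_le μ hcount _)
    _ ≤ t * ∑' b : u, D * μ (kball b.1.1 b.1.2) := by
        gcongr with b
        exact hμ.doubling _ _ (hpos _ (huT b.2))
    _ = D * ∑' b : u, t * μ (kball b.1.1 b.1.2) := by
        simp only [ENNReal.tsum_mul_left]; ring
    _ ≤ D * ∑' b : u, ∫⁻ w in kball b.1.1 b.1.2, g w ∂μ := by
        gcongr with b
        exact (ENNReal.le_div_iff_mul_le (Or.inl (hμ.pos _ _ (hpos _ (huT b.2))))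
          (Or.inl (hμ.finite _ _ (hpos _ (huT b.2))))).1 (hT _ (huT b.2)).le
    _ = D * ∫⁻ w in ⋃ b ∈ u, kball b.1 b.2, g w ∂μ := by
        rw [lintegral_biUnion hcount (fun b _ => (isOpen_kball _ _).measurableSet) hdisj]
    _ ≤ D * ∫⁻ w, g w ∂μ := by
        gcongr
        exact Measure.restrict_le_self

/-- The weak type `(1,1)` inequality. -/
lemma BallDoubling.mul_meas_lt_ballMax_le (hμ : BallDoubling μ D) (t : ℝ≥0∞) :
    t * μ {z | t < ballMax μ g z} ≤ D * ∫⁻ w, g w ∂μ := by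
  set T : ℕ → Set (Hei n × ℝ) := fun N => {b | (0 < b.2 ∧
    t < (∫⁻ w in kball b.1 b.2, g w ∂μ) / μ (kball b.1 b.2)) ∧ b.2 ≤ N} with hT
  have h : {z | t < ballMax μ g z} = ⋃ N, ⋃ b ∈ T N, kball b.1 b.2 := by
    rw [setOf_lt_ballMax]
    ext z
    simp only [mem_iUnion, exists_prop, hT, mem_ofPred_eq]
    constructor
    · rintro ⟨b, hb, hz⟩
      obtain ⟨N, hN⟩ := exists_nat_ge b.2
      exact ⟨N, b, ⟨hb, hN⟩, hz⟩
    · rintro ⟨N, b, ⟨hb, -⟩, hz⟩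
      exact ⟨b, hb, hz⟩
  have hmono : Monotone fun N => ⋃ b ∈ T N, kball b.1 b.2 := by
    intro N M hNM
    exact biUnion_subset_biUnion_left fun b hb => ⟨hb.1, hb.2.trans (by exact_mod_cast hNM)⟩
  rw [h, hmono.measure_iUnion, ENNReal.mul_iSup]
  exact iSup_le fun N => hμ.measure_biUnion_le (T N) N (fun b hb => hb.2) (fun b hb => hb.1.1)
    (fun b hb => hb.1.2)

lemma ballMax_le_add (hg : Measurable g) (t : ℝ≥0∞) (z : Hei n) :
    ballMax μ g z ≤ ballMax μ ({w | t < g w}.indicator g) z + t := by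
  refine iSup₂_le fun z₀ δ => iSup₂_le fun hδ hz => ?_
  have hms : MeasurableSet {w | t < g w} := measurableSet_lt measurable_const hg
  calc (∫⁻ w in kball z₀ δ, g w ∂μ) / μ (kball z₀ δ)
      ≤ (∫⁻ w in kball z₀ δ, ({w | t < g w}.indicator g w + t) ∂μ) / μ (kball z₀ δ) := by
        gcongr with w
        by_cases hw : t < g w
        · simp [indicator, hw]
        · simpa [indicator, hw] using not_lt.1 hw
    _ = (∫⁻ w in kball z₀ δ, {w | t < g w}.indicator g w ∂μ) / μ (kball z₀ δ) +
          t * (μ (kball z₀ δ) / μ (kball z₀ δ)) := by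
        rw [lintegral_add_left (hg.indicator hms), ENNReal.add_div, setLIntegral_const,
          mul_div_assoc]
    _ ≤ _ := by
        gcongr
        · exact le_ballMax hδ hz
        · exact mul_le_of_le_one_right' ENNReal.div_self_le_one

lemma BallDoubling.mul_meas_two_mul_lt_ballMax_le (hμ : BallDoubling μ D) (hg : Measurable g)
    {t : ℝ≥0∞} (ht : t ≠ ∞) :
    t * μ {z | 2 * t < ballMax μ g z} ≤ D * ∫⁻ w in {w | t < g w}, g w ∂μ := by
  have hms : MeasurableSet {w | t < g w} := measurableSet_lt measurable_const hg
  rw [← lintegral_indicator hms]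
  refine le_trans ?_ (hμ.mul_meas_lt_ballMax_le t)
  gcongr 1
  refine measure_mono fun z hz => ?_
  have := lt_of_lt_of_le hz (ballMax_le_add hg t z)
  rw [two_mul] at this
  exact (ENNReal.add_lt_add_iff_right ht).1 this

end MaximalFunction

section StrongType

lemma setLIntegral_rpow_indicator_le {s : ℝ} (hs : 1 < s) (a : ℝ≥0∞) :
    ∫⁻ t in Ioi (0:ℝ), ({t : ℝ | ENNReal.ofReal (t/2) < a}.indicator
      (fun t => ENNReal.ofReal (t ^ (s-2))) t) ≤
      ENNReal.ofReal (2 ^ (s-1) / (s-1)) * a ^ (s-1) := by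
  have hc : 0 < (2:ℝ) ^ (s-1) / (s-1) := div_pos (by positivity) (by linarith)
  rcases eq_or_ne a ∞ with rfl | ha
  · rw [ENNReal.top_rpow_of_pos (by linarith), ENNReal.mul_top (by simpa using hc)]
    exact le_top
  lift a to NNReal using ha
  have h1 : ∀ t ∈ Ioi (0:ℝ), {t : ℝ | ENNReal.ofReal (t/2) < a}.indicator
      (fun t => ENNReal.ofReal (t ^ (s-2))) t ≤
      (Ioc 0 (2 * (a:ℝ))).indicator (fun t => ENNReal.ofReal (t ^ (s-2))) t := by
    intro t ht
    by_cases h : ENNReal.ofReal (t/2) < a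
    · have h' : t / 2 < a := (ENNReal.ofReal_lt_coe_iff (by have := mem_Ioi.1 ht; positivity)).1 h
      have : t ∈ Ioc 0 (2 * (a:ℝ)) := ⟨ht, by linarith⟩
      rw [indicator_of_mem this]
      exact indicator_le_self _ _ _
    · have : t ∉ {t : ℝ | ENNReal.ofReal (t/2) < (a:ℝ≥0∞)} := h
      rw [indicator_of_notMem this]
      exact zero_le
  have hint : IntervalIntegrable (fun t : ℝ => t ^ (s-2)) volume 0 (2 * (a:ℝ)) :=
    intervalIntegral.intervalIntegrable_rpow' (by linarith)
  have ha0 : 0 ≤ 2 * (a:ℝ) := by positivity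
  refine (setLIntegral_mono' measurableSet_Ioi h1).trans ?_
  calc _ ≤ ∫⁻ t, (Ioc 0 (2 * (a:ℝ))).indicator (fun t => ENNReal.ofReal (t ^ (s-2))) t :=
        setLIntegral_le_lintegral _ _
    _ = ∫⁻ t in Ioc 0 (2 * (a:ℝ)), ENNReal.ofReal (t ^ (s-2)) :=
        lintegral_indicator measurableSet_Ioc _
    _ = ENNReal.ofReal (∫ t in Ioc 0 (2 * (a:ℝ)), t ^ (s-2)) := by
        rw [ofReal_integral_eq_lintegral_ofReal]
        · exact (intervalIntegrable_iff_integrableOn_Ioc_of_le ha0).1 hint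
        · exact (ae_restrict_mem measurableSet_Ioc).mono fun t ht =>
            Real.rpow_nonneg ht.1.le _
    _ = ENNReal.ofReal (2 ^ (s-1) / (s-1) * (a:ℝ) ^ (s-1)) := by
        rw [← intervalIntegral.integral_of_le ha0, integral_rpow (Or.inl (by linarith))]
        congr 1
        rw [show s - 2 + 1 = s - 1 by ring, Real.zero_rpow (by linarith),
          Real.mul_rpow (by norm_num) a.coe_nonneg]
        ring
    _ = ENNReal.ofReal (2 ^ (s-1) / (s-1)) * (a:ℝ≥0∞) ^ (s-1) := by
        rw [ENNReal.ofReal_mul hc.le, ← ENNReal.ofReal_rpow_of_nonneg a.coe_nonneg (by linarith),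
          ENNReal.ofReal_coe_nnreal]
    _ ≤ _ := le_rfl

lemma lintegral_rpow_le_of_forall_min {α : Type*} [MeasurableSpace α] {μ : Measure α}
    {F : α → ℝ≥0∞} (hF : Measurable F) {s : ℝ} (hs : 0 ≤ s) {K : ℝ≥0∞}
    (h : ∀ N : ℕ, ∫⁻ z, (min (F z) N) ^ s ∂μ ≤ K) : ∫⁻ z, F z ^ s ∂μ ≤ K := by
  refine le_of_tendsto' (lintegral_tendsto_of_tendsto_of_monotone
    (f := fun (N : ℕ) z => (min (F z) N) ^ s) (fun N => ?_) ?_ ?_) h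
  · exact ((hF.min measurable_const).pow_const s).aemeasurable
  · refine Filter.Eventually.of_forall fun z N M hNM => ?_
    dsimp only
    gcongr
  · refine Filter.Eventually.of_forall fun z => ?_
    have h1 : Filter.Tendsto (fun N : ℕ => min (F z) (N : ℝ≥0∞)) Filter.atTop
        (nhds (min (F z) ∞)) := tendsto_const_nhds.min ENNReal.tendsto_nat_nhds_top
    rw [min_eq_left le_top] at h1
    exact ((ENNReal.continuous_rpow_const (y := s)).tendsto _).comp h1

lemma lintegral_min_rpow_le {α : Type*} [MeasurableSpace α] {μ : Measure α}
    {F : α → ℝ≥0∞} (hF : Measurable F) {s : ℝ} (hs : 0 < s) (N : ℕ) :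
    ∫⁻ z, (min (F z) N) ^ s ∂μ ≤ ENNReal.ofReal s *
      ∫⁻ t in Ioi (0:ℝ), μ {z | ENNReal.ofReal t < F z} * ENNReal.ofReal (t ^ (s - 1)) := by
  have hne (z : α) : min (F z) (N : ℝ≥0∞) ≠ ∞ :=
    ((min_le_right _ _).trans_lt (ENNReal.natCast_lt_top N)).ne
  have h1 := lintegral_rpow_eq_lintegral_meas_lt_mul μ (f := fun z => (min (F z) N).toReal)
    (Filter.Eventually.of_forall fun z => ENNReal.toReal_nonneg)
    ((hF.min measurable_const).ennreal_toReal.aemeasurable) hs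
  have h2 (z : α) : ENNReal.ofReal ((min (F z) N).toReal ^ s) = (min (F z) N) ^ s := by
    rw [← ENNReal.ofReal_rpow_of_nonneg ENNReal.toReal_nonneg hs.le, ENNReal.ofReal_toReal (hne z)]
  simp only [h2] at h1
  rw [h1]
  gcongr ENNReal.ofReal s * ?_
  refine setLIntegral_mono' measurableSet_Ioi fun t ht => ?_
  gcongr 1
  refine measure_mono fun z hz => ?_
  exact lt_of_lt_of_le ((ENNReal.ofReal_lt_iff_lt_toReal (le_of_lt ht) (hne z)).2 hz)
    (min_le_left _ _)

/-- The strong type `(s,s)` inequality for `s > 1`. -/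
lemma BallDoubling.lintegral_ballMax_rpow_le {μ : Measure (Hei n)} [SFinite μ] {D : ℝ≥0∞}
    (hμ : BallDoubling μ D) {s : ℝ} (hs : 1 < s) :
    ∃ C : ℝ≥0∞, C ≠ ∞ ∧ ∀ g : Hei n → ℝ≥0∞, Measurable g →
      ∫⁻ z, ballMax μ g z ^ s ∂μ ≤ C * ∫⁻ z, g z ^ s ∂μ := by
  refine ⟨ENNReal.ofReal s * (2 * D * ENNReal.ofReal (2 ^ (s-1) / (s-1))),
    mul_ne_top ofReal_ne_top (mul_ne_top (mul_ne_top (by simp) hμ.ne_top) ofReal_ne_top),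
    fun g hg => lintegral_rpow_le_of_forall_min measurable_ballMax (by linarith) fun N => ?_⟩
  refine (lintegral_min_rpow_le measurable_ballMax (by linarith) N).trans ?_
  rw [mul_assoc]
  gcongr ENNReal.ofReal s * ?_
  set k : ℝ → Hei n → ℝ≥0∞ := fun t w =>
    {t : ℝ | ENNReal.ofReal (t/2) < g w}.indicator (fun t => ENNReal.ofReal (t ^ (s-2))) t * g w
    with hk
  have hkm : Measurable (Function.uncurry k) := by
    have hms : MeasurableSet {v : ℝ × Hei n | ENNReal.ofReal (v.1/2) < g v.2} :=
      measurableSet_lt (by fun_prop) (hg.comp measurable_snd)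
    have h1 : Measurable fun v : ℝ × Hei n => ENNReal.ofReal (v.1 ^ (s-2)) := by fun_prop
    exact (h1.indicator hms).mul (hg.comp measurable_snd)
  have hweak : ∀ t ∈ Ioi (0:ℝ), μ {z | ENNReal.ofReal t < ballMax μ g z} *
      ENNReal.ofReal (t ^ (s-1)) ≤ 2 * D * ∫⁻ w, k t w ∂μ := by
    intro t ht
    have ht : 0 < t := ht
    have h1 := hμ.mul_meas_two_mul_lt_ballMax_le hg (t := ENNReal.ofReal (t/2)) ofReal_ne_top
    have h2 : 2 * ENNReal.ofReal (t/2) = ENNReal.ofReal t := by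
      rw [← ENNReal.ofReal_ofNat, ← ENNReal.ofReal_mul (by norm_num)]; congr 1; ring
    rw [h2] at h1
    have h3 : ENNReal.ofReal (t ^ (s-1)) =
        2 * ENNReal.ofReal (t/2) * ENNReal.ofReal (t ^ (s-2)) := by
      rw [h2, ← ENNReal.ofReal_mul ht.le]
      congr 1
      rw [show s - 1 = 1 + (s-2) by ring, Real.rpow_add ht, Real.rpow_one]
    have hms : MeasurableSet {w | ENNReal.ofReal (t/2) < g w} :=
      measurableSet_lt measurable_const hg
    have h4 : ∫⁻ w, k t w ∂μ =
        ENNReal.ofReal (t ^ (s-2)) * ∫⁻ w in {w | ENNReal.ofReal (t/2) < g w}, g w ∂μ := by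
      rw [← lintegral_indicator hms, ← lintegral_const_mul _ (hg.indicator hms)]
      refine lintegral_congr fun w => ?_
      by_cases hw : ENNReal.ofReal (t/2) < g w <;> simp [hk, indicator, hw]
    rw [h3, h4]
    calc _ = 2 * ENNReal.ofReal (t ^ (s-2)) *
          (ENNReal.ofReal (t/2) * μ {z | ENNReal.ofReal t < ballMax μ g z}) := by ring
      _ ≤ 2 * ENNReal.ofReal (t ^ (s-2)) *
          (D * ∫⁻ w in {w | ENNReal.ofReal (t/2) < g w}, g w ∂μ) := by gcongr
      _ = _ := by ring
  refine (setLIntegral_mono' measurableSet_Ioi hweak).trans ?_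
  have hI : Measurable fun t => ∫⁻ w, k t w ∂μ := hkm.lintegral_prod_right'
  rw [lintegral_const_mul _ hI, mul_assoc (2 * D)]
  gcongr 2 * D * ?_
  rw [lintegral_lintegral_swap hkm.aemeasurable, ← lintegral_const_mul _ (hg.pow_const s)]
  refine lintegral_mono fun w => ?_
  have hm : Measurable fun t : ℝ => {t : ℝ | ENNReal.ofReal (t/2) < g w}.indicator
      (fun t => ENNReal.ofReal (t ^ (s-2))) t :=
    Measurable.indicator (by fun_prop) (measurableSet_lt (by fun_prop) measurable_const)
  simp only [hk]
  rw [lintegral_mul_const _ hm]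
  calc _ ≤ ENNReal.ofReal (2 ^ (s-1) / (s-1)) * g w ^ (s-1) * g w := by
        gcongr; exact setLIntegral_rpow_indicator_le hs (g w)
    _ = ENNReal.ofReal (2 ^ (s-1) / (s-1)) * g w ^ s := by
        rw [mul_assoc]
        congr 1
        nth_rw 2 [← ENNReal.rpow_one (g w)]
        rw [← ENNReal.rpow_add_of_nonneg _ _ (by linarith) zero_le_one]
        congr 1; ring

end StrongType

section Weights

lemma volume_le_rpow_mul_rpow {w₁ w₂ : Hei n → ℝ≥0∞} (hm₁ : Measurable w₁) (hm₂ : Measurable w₂)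
    {a b : ℝ} (ha : 0 < a) (hb : 0 < b) (h : ∀ᵐ z, w₁ z ^ a * w₂ z ^ b = 1) {B : Set (Hei n)}
    (hB : MeasurableSet B) :
    volume B ^ (a + b) ≤ volume.withDensity w₁ B ^ a * volume.withDensity w₂ B ^ b := by
  have hab : 0 < a + b := by linarith
  have hconj : ((a + b) / a).HolderConjugate ((a + b) / b) := by
    rw [Real.holderConjugate_iff]
    refine ⟨by rw [lt_div_iff₀ ha]; linarith, ?_⟩
    field_simp
  have hH := ENNReal.lintegral_mul_le_Lp_mul_Lq (volume.restrict B) hconj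
    (hm₁.pow_const (a / (a + b))).aemeasurable (hm₂.pow_const (b / (a + b))).aemeasurable
  have e1 (x : ℝ≥0∞) : (x ^ (a / (a + b))) ^ ((a + b) / a) = x := by
    rw [← ENNReal.rpow_mul, div_mul_div_cancel₀ hab.ne', div_self ha.ne', ENNReal.rpow_one]
  have e2 (x : ℝ≥0∞) : (x ^ (b / (a + b))) ^ ((a + b) / b) = x := by
    rw [← ENNReal.rpow_mul, div_mul_div_cancel₀ hab.ne', div_self hb.ne', ENNReal.rpow_one]
  have e3 : ∫⁻ z in B, ((fun z => w₁ z ^ (a / (a + b))) * fun z => w₂ z ^ (b / (a + b))) z =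
      volume B := by
    rw [← setLIntegral_one]
    refine lintegral_congr_ae ((ae_restrict_of_ae h).mono fun z hz => ?_)
    simp only [Pi.mul_apply]
    rw [div_eq_mul_inv, div_eq_mul_inv, ENNReal.rpow_mul, ENNReal.rpow_mul,
      ← ENNReal.mul_rpow_of_nonneg _ _ (by positivity), hz, ENNReal.one_rpow]
  simp only [e1, e2] at hH
  rw [e3, ← withDensity_apply _ hB, ← withDensity_apply _ hB, one_div_div, one_div_div] at hH
  refine (ENNReal.rpow_le_rpow hH hab.le).trans_eq ?_
  rw [ENNReal.mul_rpow_of_nonneg _ _ hab.le, ← ENNReal.rpow_mul, ← ENNReal.rpow_mul,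
    div_mul_cancel₀ _ hab.ne', div_mul_cancel₀ _ hab.ne']

lemma exists_ballDoubling_withDensity {w₁ w₂ : Hei n → ℝ≥0∞}
    (hm₁ : Measurable w₁) (hm₂ : Measurable w₂)
    (h0₁ : ∀ᵐ z, w₁ z ≠ 0) (h0₂ : ∀ᵐ z, w₂ z ≠ 0)
    {a b : ℝ} (ha : 0 < a) (hb : 0 < b) (h : ∀ᵐ z, w₁ z ^ a * w₂ z ^ b = 1)
    {K : ℝ≥0∞} (hK : K ≠ ∞)
    (hA : ∀ (z : Hei n) (δ : ℝ), 0 < δ → volume.withDensity w₁ (kball z δ) ^ a *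
      volume.withDensity w₂ (kball z δ) ^ b ≤ K * volume (kball z δ) ^ (a + b)) :
    ∃ D, BallDoubling (volume.withDensity w₁) D := by
  obtain ⟨D, hD, hvol⟩ := exists_volume_kball_le n
  have hab : 0 < a + b := by linarith
  have hpos₁ (z : Hei n) (δ : ℝ) (hδ : 0 < δ) : volume.withDensity w₁ (kball z δ) ≠ 0 := fun h0 =>
    (volume_kball_pos z hδ).ne' (withDensity_absolutelyContinuous' hm₁.aemeasurable h0₁ h0)
  have hpos₂ (z : Hei n) (δ : ℝ) (hδ : 0 < δ) : volume.withDensity w₂ (kball z δ) ≠ 0 := fun h0 =>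
    (volume_kball_pos z hδ).ne' (withDensity_absolutelyContinuous' hm₂.aemeasurable h0₂ h0)
  have hfin (z : Hei n) (δ : ℝ) (hδ : 0 < δ) : volume.withDensity w₁ (kball z δ) ≠ ∞ := by
    intro htop
    have h1 := hA z δ hδ
    have h2 : volume.withDensity w₂ (kball z δ) ^ b ≠ 0 := fun h0 => by
      rcases ENNReal.rpow_eq_zero_iff.1 h0 with h3 | h3
      · exact hpos₂ z δ hδ h3.1
      · linarith [h3.2]
    rw [htop, ENNReal.top_rpow_of_pos ha, ENNReal.top_mul h2, top_le_iff] at h1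
    exact mul_ne_top hK (ENNReal.rpow_ne_top_of_nonneg hab.le (volume_kball_lt_top z δ).ne) h1
  refine ⟨(K * D ^ (a + b)) ^ (1 / a), ?_, hpos₁, hfin, fun z δ hδ => ?_⟩
  · exact ENNReal.rpow_ne_top_of_nonneg (by positivity)
      (mul_ne_top hK (ENNReal.rpow_ne_top_of_nonneg hab.le hD))
  set B := kball z δ
  set B' := kball z (16 * δ) with hB'
  have hδ' : 0 < 16 * δ := by positivity
  have hBB' : B ⊆ B' := fun w hw => by
    have : knorm (hmul (hinv z) w) < δ := hw
    simp only [hB', kball, mem_ofPred_eq]; linarith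
  have hV0 : volume B ^ (a + b) ≠ 0 := fun h0 => by
    rcases ENNReal.rpow_eq_zero_iff.1 h0 with h3 | h3
    · exact (volume_kball_pos z hδ).ne' h3.1
    · linarith [h3.2]
  have hVt : volume B ^ (a + b) ≠ ∞ :=
    ENNReal.rpow_ne_top_of_nonneg hab.le (volume_kball_lt_top z δ).ne
  have key : volume B ^ (a + b) * volume.withDensity w₁ B' ^ a ≤
      volume B ^ (a + b) * (K * D ^ (a + b) * volume.withDensity w₁ B ^ a) := by
    calc _ ≤ volume.withDensity w₁ B ^ a * volume.withDensity w₂ B' ^ b *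
          volume.withDensity w₁ B' ^ a := by
          gcongr
          exact (volume_le_rpow_mul_rpow hm₁ hm₂ ha hb h (isOpen_kball z δ).measurableSet).trans
            (by gcongr)
      _ = volume.withDensity w₁ B ^ a * (volume.withDensity w₁ B' ^ a *
          volume.withDensity w₂ B' ^ b) := by ring
      _ ≤ volume.withDensity w₁ B ^ a * (K * volume B' ^ (a + b)) := by
          gcongr _ * ?_
          exact hA z _ hδ'
      _ ≤ volume.withDensity w₁ B ^ a * (K * (D * volume B) ^ (a + b)) := by
          gcongr
          exact hvol z δ
      _ = _ := by rw [ENNReal.mul_rpow_of_nonneg _ _ hab.le]; ring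
  have key' := ENNReal.rpow_le_rpow ((ENNReal.mul_le_mul_iff_right hV0 hVt).1 key)
    (by positivity : 0 ≤ 1 / a)
  rw [ENNReal.mul_rpow_of_nonneg _ _ (by positivity : 0 ≤ 1 / a), ← ENNReal.rpow_mul,
    ← ENNReal.rpow_mul, mul_one_div_cancel ha.ne', ENNReal.rpow_one, ENNReal.rpow_one] at key'
  exact key'

end Weights

section Fractional

lemma rpow_average_le {V U S X H K : ℝ≥0∞} {p q p₁ t : ℝ} (hp : p.HolderConjugate p₁)
    (hpq : p < q) (ht : t = q - 1 / (1/q + 1/p₁))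
    (hV0 : V ≠ 0) (hV : V ≠ ∞) (hU0 : U ≠ 0) (hU : U ≠ ∞) (hS0 : S ≠ 0) (hS : S ≠ ∞)
    (hA : U ^ (1/q) * S ^ (1/p₁) ≤ K * V ^ (1/q + 1/p₁))
    (hX : X ≤ H ^ (1/p) * S ^ (1/p₁)) :
    (V ^ (-(1/q + 1/p₁)) * X) ^ t ≤ K ^ q * H ^ ((1/p - 1/q) * t) *
      (V * (X / S) ^ (p * t / q) / U) := by
  have hp0 := hp.pos
  have hp10 := hp.symm.pos
  have hq0 : 0 < q := hp0.trans hpq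
  have hsum : 1/p + 1/p₁ = 1 := by simpa using hp.inv_add_inv_eq_one
  set r := 1/q + 1/p₁ with hr
  have hr0 : 0 < r := by positivity
  have hrq : r * q = 1 + q / p₁ := by rw [hr]; field_simp
  have hrt : r * t = q / p₁ := by
    rw [ht, mul_sub, mul_one_div_cancel hr0.ne', hrq]; ring
  have ht0 : 0 < t := by
    have : 0 < r * t := by rw [hrt]; positivity
    exact (mul_pos_iff_of_pos_left hr0).1 this
  have hγ : 0 < 1/p - 1/q := sub_pos.2 (one_div_lt_one_div_of_lt hp0 hpq)
  have hpq1 : 0 < 1 - p/q := by rw [sub_pos, div_lt_one hq0]; exact hpq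
  have hY : X / S ≤ H ^ (1/p) * S ^ (-(1/p)) := by
    rw [ENNReal.div_le_iff hS0 hS]
    refine hX.trans_eq ?_
    rw [mul_assoc]
    congr 1
    nth_rw 3 [← ENNReal.rpow_one S]
    rw [← ENNReal.rpow_add _ _ hS0 hS]
    congr 1; linarith
  have hXS : X = X / S * S := (ENNReal.div_mul_cancel hS0 hS).symm
  have hX2 : X ≤ (X / S) ^ (p/q) * H ^ (1/p - 1/q) * S ^ r := by
    calc X = (X / S) ^ (p/q) * (X / S) ^ (1 - p/q) * S := by
          rw [← ENNReal.rpow_add_of_nonneg _ _ (by positivity) hpq1.le]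
          simp only [add_sub_cancel, ENNReal.rpow_one]
          exact hXS
      _ ≤ (X / S) ^ (p/q) * (H ^ (1/p) * S ^ (-(1/p))) ^ (1 - p/q) * S := by gcongr
      _ = _ := by
          rw [ENNReal.mul_rpow_of_nonneg _ _ hpq1.le, ← ENNReal.rpow_mul, ← ENNReal.rpow_mul]
          nth_rw 3 [← ENNReal.rpow_one S]
          rw [mul_assoc, mul_assoc, ← ENNReal.rpow_add _ _ hS0 hS, ← mul_assoc]
          congr 2
          · congr 1; field_simp
          · have : 1/p * (p/q) = 1/q := by field_simp
            rw [hr]; linear_combination this - hsum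
  have hSU : V ^ (-(r * t)) * S ^ (r * t) ≤ K ^ q * (V / U) := by
    have h1 := ENNReal.rpow_le_rpow hA hq0.le
    rw [ENNReal.mul_rpow_of_nonneg _ _ hq0.le, ENNReal.mul_rpow_of_nonneg _ _ hq0.le,
      ← ENNReal.rpow_mul, ← ENNReal.rpow_mul, ← ENNReal.rpow_mul, one_div_mul_cancel hq0.ne',
      ENNReal.rpow_one, one_div_mul_eq_div, ← hrt] at h1
    rw [← mul_div_assoc, ENNReal.le_div_iff_mul_le (Or.inl hU0) (Or.inl hU)]
    calc _ = V ^ (-(r * t)) * (U * S ^ (r * t)) := by ring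
      _ ≤ V ^ (-(r * t)) * (K ^ q * V ^ (r * q)) := by gcongr
      _ = K ^ q * (V ^ (-(r * t)) * V ^ (r * q)) := by ring
      _ = K ^ q * V := by
          rw [← ENNReal.rpow_add _ _ hV0 hV, hrt, hrq]
          simp
  calc (V ^ (-r) * X) ^ t
      ≤ (V ^ (-r) * ((X / S) ^ (p/q) * H ^ (1/p - 1/q) * S ^ r)) ^ t := by gcongr
    _ = (V ^ (-(r * t)) * S ^ (r * t)) * (H ^ ((1/p - 1/q) * t) * (X / S) ^ (p * t / q)) := by
        simp only [ENNReal.mul_rpow_of_nonneg _ _ ht0.le, ← ENNReal.rpow_mul]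
        rw [neg_mul, show p / q * t = p * t / q by ring]
        ring
    _ ≤ K ^ q * (V / U) * (H ^ ((1/p - 1/q) * t) * (X / S) ^ (p * t / q)) := by gcongr
    _ = _ := by simp only [div_eq_mul_inv]; ring

lemma setLIntegral_eq_setLIntegral_withDensity {W F : Hei n → ℝ≥0∞} (hW : Measurable W)
    (hF : Measurable F) (h0 : ∀ᵐ z, W z ≠ 0) (ht : ∀ᵐ z, W z ≠ ∞) (e : ℝ) {B : Set (Hei n)}
    (hB : MeasurableSet B) :
    ∫⁻ z in B, F z = ∫⁻ z in B, F z * W z ^ (-e) ∂(volume.withDensity fun z => W z ^ e) := by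
  have hFW : Measurable fun z => F z * W z ^ (-e) := hF.mul (hW.pow_const _)
  rw [restrict_withDensity hB, lintegral_withDensity_eq_lintegral_mul _ (hW.pow_const e) hFW]
  refine lintegral_congr_ae ((ae_restrict_of_ae (h0.and ht)).mono fun z hz => ?_)
  simp only [Pi.mul_apply]
  rw [mul_left_comm, ← ENNReal.rpow_add _ _ hz.1 hz.2]
  simp

lemma lintegral_mul_rpow_withDensity {W F : Hei n → ℝ≥0∞} (hW : Measurable W)
    (hF : Measurable F) (h0 : ∀ᵐ z, W z ≠ 0) (htop : ∀ᵐ z, W z ≠ ∞) {p p₁ : ℝ}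
    (hp : p.HolderConjugate p₁) :
    ∫⁻ z, (F z * W z ^ p₁) ^ p ∂(volume.withDensity fun z => W z ^ (-p₁)) =
      ∫⁻ z, F z ^ p * W z ^ p := by
  have hFW : Measurable fun z => (F z * W z ^ p₁) ^ p := (hF.mul (hW.pow_const _)).pow_const p
  rw [lintegral_withDensity_eq_lintegral_mul _ (hW.pow_const _) hFW]
  refine lintegral_congr_ae ((h0.and htop).mono fun z hz => ?_)
  simp only [Pi.mul_apply]
  rw [ENNReal.mul_rpow_of_nonneg _ _ hp.nonneg, ← ENNReal.rpow_mul, mul_left_comm,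
    ← ENNReal.rpow_add _ _ hz.1 hz.2]
  congr 2
  linear_combination hp.mul_eq_add

lemma fracMax_rpow_le {W : Hei n → ℝ≥0∞} (hW : Measurable W)
    (h0 : ∀ᵐ z, W z ≠ 0) (htop : ∀ᵐ z, W z ≠ ∞)
    {α p q p₁ t : ℝ} (hp : p.HolderConjugate p₁) (hpq : p < q)
    (hα : α / Q n - 1 = -(1/q + 1/p₁)) (ht : t = q - 1 / (1/q + 1/p₁)) (ht0 : 0 < t)
    {K D₁ D₂ : ℝ≥0∞} (hu : BallDoubling (volume.withDensity fun z => W z ^ q) D₁)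
    (hs : BallDoubling (volume.withDensity fun z : Hei n => W z ^ (-p₁)) D₂)
    (hA : ∀ (z : Hei n) (δ : ℝ), 0 < δ →
      volume.withDensity (fun z => W z ^ q) (kball z δ) ^ (1/q) *
        volume.withDensity (fun z => W z ^ (-p₁)) (kball z δ) ^ (1/p₁) ≤
          K * volume (kball z δ) ^ (1/q + 1/p₁))
    {f : Hei n → ℝ} (hf : Measurable f) (z : Hei n) :
    fracMax α f z ^ t ≤ K ^ q *
      (∫⁻ y, ENNReal.ofReal |f y| ^ p * W y ^ p) ^ ((1/p - 1/q) * t) *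
        ballMax (volume.withDensity fun z => W z ^ q)
          (fun y => ballMax (volume.withDensity fun z => W z ^ (-p₁))
            (fun y => ENNReal.ofReal |f y| * W y ^ p₁) y ^ (p * t / q) * W y ^ (-q)) z := by
  set u := volume.withDensity fun z => W z ^ q with hu_def
  set σ := volume.withDensity fun z => W z ^ (-p₁) with hσ_def
  set h : Hei n → ℝ≥0∞ := fun y => ENNReal.ofReal |f y| * W y ^ p₁ with hh
  set H := ∫⁻ y, ENNReal.ofReal |f y| ^ p * W y ^ p with hH
  have hF : Measurable fun y => ENNReal.ofReal |f y| := by fun_prop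
  have hhm : Measurable h := hF.mul (hW.pow_const _)
  have hHσ : ∫⁻ y, h y ^ p ∂σ = H := lintegral_mul_rpow_withDensity hW hF h0 htop hp
  rw [← ENNReal.le_rpow_inv_iff ht0]
  refine iSup₂_le fun z₀ δ => iSup₂_le fun hδ hz => ?_
  rw [ENNReal.le_rpow_inv_iff ht0, hα]
  have hB := (isOpen_kball z₀ δ).measurableSet
  have hFh := setLIntegral_eq_setLIntegral_withDensity hW hF h0 htop (-p₁) hB
  rw [neg_neg] at hFh
  rw [hFh]
  have hHol : ∫⁻ y in kball z₀ δ, h y ∂σ ≤ H ^ (1/p) * σ (kball z₀ δ) ^ (1/p₁) := by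
    have h1 := ENNReal.lintegral_mul_le_Lp_mul_Lq (σ.restrict (kball z₀ δ)) hp
      hhm.aemeasurable (aemeasurable_const (b := (1 : ℝ≥0∞)))
    simp only [Pi.mul_apply, mul_one, ENNReal.one_rpow, lintegral_const, one_mul,
      Measure.restrict_apply_univ] at h1
    refine h1.trans ?_
    gcongr
    · exact one_div_nonneg.2 hp.nonneg
    · rw [← hHσ]; exact setLIntegral_le_lintegral _ _
  refine (rpow_average_le hp hpq ht (volume_kball_pos z₀ hδ).ne' (volume_kball_lt_top z₀ δ).ne
    (hu.pos _ _ hδ) (hu.finite _ _ hδ) (hs.pos _ _ hδ) (hs.finite _ _ hδ) (hA z₀ δ hδ) hHol).trans ?_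
  gcongr _ * ?_
  refine le_trans ?_ (le_ballMax hδ hz)
  gcongr ?_ / _
  have hpt : 0 ≤ p * t / q := div_nonneg (mul_nonneg hp.nonneg ht0.le) (hp.pos.trans hpq).le
  rw [← setLIntegral_eq_setLIntegral_withDensity hW (measurable_ballMax.pow_const _) h0 htop q hB,
    mul_comm, ← setLIntegral_const]
  refine setLIntegral_mono' hB fun y hy => ?_
  exact ENNReal.rpow_le_rpow (le_ballMax hδ hy) hpt

lemma lintegral_fracMax_rpow_le {W : Hei n → ℝ≥0∞} (hW : Measurable W)
    (h0 : ∀ᵐ z, W z ≠ 0) (htop : ∀ᵐ z, W z ≠ ∞)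
    {α p q p₁ : ℝ} (hp : p.HolderConjugate p₁) (hpq : p < q)
    (hα : α / Q n - 1 = -(1/q + 1/p₁)) {K : ℝ≥0∞} (hK : K ≠ ∞)
    (hA : ∀ (z : Hei n) (δ : ℝ), 0 < δ →
      volume.withDensity (fun z => W z ^ q) (kball z δ) ^ (1/q) *
        volume.withDensity (fun z => W z ^ (-p₁)) (kball z δ) ^ (1/p₁) ≤
          K * volume (kball z δ) ^ (1/q + 1/p₁)) :
    ∃ C : ℝ≥0∞, C ≠ ∞ ∧ ∀ f : Hei n → ℝ, Measurable f →
      (∫⁻ z, fracMax α f z ^ q * W z ^ q) ≤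
        C * (∫⁻ z, ENNReal.ofReal |f z| ^ p * W z ^ p) ^ (q / p) := by
  have hp0 := hp.pos
  have hp10 := hp.symm.pos
  have hq0 : 0 < q := hp0.trans hpq
  have hone : ∀ᵐ z, (W z ^ q) ^ (1/q) * (W z ^ (-p₁)) ^ (1/p₁) = 1 := by
    filter_upwards [h0, htop] with z hz hz'
    rw [← ENNReal.rpow_mul, ← ENNReal.rpow_mul, ← ENNReal.rpow_add _ _ hz hz',
      mul_one_div_cancel hq0.ne', neg_mul, mul_one_div_cancel hp10.ne']
    simp
  have hne0 (e : ℝ) : ∀ᵐ z, W z ^ e ≠ 0 := by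
    filter_upwards [h0, htop] with z hz hz'
    exact (ENNReal.rpow_pos (pos_iff_ne_zero.2 hz) hz').ne'
  obtain ⟨D₁, hu⟩ := exists_ballDoubling_withDensity (hW.pow_const q) (hW.pow_const (-p₁))
    (hne0 _) (hne0 _) (one_div_pos.2 hq0) (one_div_pos.2 hp10) hone hK hA
  obtain ⟨D₂, hs⟩ := exists_ballDoubling_withDensity (hW.pow_const (-p₁)) (hW.pow_const q)
    (hne0 _) (hne0 _) (one_div_pos.2 hp10) (one_div_pos.2 hq0)
    (hone.mono fun z hz => by rw [mul_comm]; exact hz) hK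
    (fun z δ hδ => by rw [mul_comm, add_comm (1/p₁)]; exact hA z δ hδ)
  set r := 1/q + 1/p₁ with hr
  have hr0 : 0 < r := by positivity
  have hrq : r * q = 1 + q / p₁ := by rw [hr]; field_simp
  obtain ⟨t, ht⟩ : ∃ t, t = q - 1 / r := ⟨_, rfl⟩
  have hrt : r * t = q / p₁ := by
    rw [ht, mul_sub, mul_one_div_cancel hr0.ne', hrq]; ring
  have ht0 : 0 < t := by
    have : 0 < r * t := by rw [hrt]; positivity
    exact (mul_pos_iff_of_pos_left hr0).1 this
  obtain ⟨s, hs_def⟩ : ∃ s, s = q / t := ⟨_, rfl⟩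
  have hts : t * s = q := by rw [hs_def]; field_simp
  have hs1 : 1 < s := by
    rw [hs_def, one_lt_div ht0, ht]
    have : 0 < 1 / r := by positivity
    linarith
  have hsr : s = r * p₁ := by
    rw [hs_def, div_eq_iff ht0.ne']
    calc q = q / p₁ * p₁ := by field_simp
      _ = r * p₁ * t := by rw [← hrt]; ring
  have hexp : q + -q * s = -p₁ := by
    have : r * q * p₁ = (1 + q / p₁) * p₁ := by rw [hrq]
    have h2 : q / p₁ * p₁ = q := by field_simp
    rw [hsr]; linear_combination -h2 - this
  obtain ⟨C₁, hC₁, hM₁⟩ := hu.lintegral_ballMax_rpow_le hs1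
  obtain ⟨C₂, hC₂, hM₂⟩ := hs.lintegral_ballMax_rpow_le hp.lt
  refine ⟨(K ^ q) ^ s * C₁ * C₂, mul_ne_top (mul_ne_top (ENNReal.rpow_ne_top_of_nonneg
    (by linarith) (ENNReal.rpow_ne_top_of_nonneg hq0.le hK)) hC₁) hC₂, fun f hf => ?_⟩
  have hpt := fracMax_rpow_le hW h0 htop hp hpq hα ht ht0 hu hs hA hf
  set u := volume.withDensity fun z => W z ^ q with hu_def
  set σ := volume.withDensity fun z => W z ^ (-p₁) with hσ_def
  set h : Hei n → ℝ≥0∞ := fun y => ENNReal.ofReal |f y| * W y ^ p₁ with hh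
  set H := ∫⁻ y, ENNReal.ofReal |f y| ^ p * W y ^ p with hH
  have hF : Measurable fun y => ENNReal.ofReal |f y| := by fun_prop
  have hhm : Measurable h := hF.mul (hW.pow_const _)
  have hHσ : ∫⁻ y, h y ^ p ∂σ = H := lintegral_mul_rpow_withDensity hW hF h0 htop hp
  set G : Hei n → ℝ≥0∞ := fun y => ballMax σ h y ^ (p * t / q) * W y ^ (-q) with hG
  have hGm : Measurable G := (measurable_ballMax.pow_const _).mul (hW.pow_const _)
  have hGs : ∫⁻ y, G y ^ s ∂u = ∫⁻ y, ballMax σ h y ^ p ∂σ := by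
    rw [hu_def, lintegral_withDensity_eq_lintegral_mul _ (hW.pow_const _) (hGm.pow_const s)]
    conv_rhs => rw [hσ_def, lintegral_withDensity_eq_lintegral_mul _ (hW.pow_const _)
      (measurable_ballMax.pow_const p)]
    refine lintegral_congr_ae ((h0.and htop).mono fun y hy => ?_)
    simp only [Pi.mul_apply, hG]
    rw [ENNReal.mul_rpow_of_nonneg _ _ (by linarith), ← ENNReal.rpow_mul, ← ENNReal.rpow_mul,
      mul_left_comm, ← ENNReal.rpow_add _ _ hy.1 hy.2, hexp, mul_comm]
    congr 2
    rw [div_mul_eq_mul_div, mul_assoc, hts, mul_div_assoc, div_self hq0.ne', mul_one]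
  have hbd (z : Hei n) : fracMax α f z ^ q ≤
      (K ^ q) ^ s * H ^ (q / p - 1) * ballMax u G z ^ s := by
    have h1 := ENNReal.rpow_le_rpow (hpt z) (by linarith : 0 ≤ s)
    rw [← ENNReal.rpow_mul, hts, ENNReal.mul_rpow_of_nonneg _ _ (by linarith),
      ENNReal.mul_rpow_of_nonneg _ _ (by linarith), ← ENNReal.rpow_mul H, mul_assoc _ t s, hts,
      show (1/p - 1/q) * q = q/p - 1 by field_simp] at h1
    exact h1
  have hBm : Measurable fun z => ballMax u G z ^ s := measurable_ballMax.pow_const _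
  calc ∫⁻ z, fracMax α f z ^ q * W z ^ q
      ≤ ∫⁻ z, (K ^ q) ^ s * H ^ (q / p - 1) * (W z ^ q * ballMax u G z ^ s) := by
        refine lintegral_mono fun z => ?_
        calc _ ≤ (K ^ q) ^ s * H ^ (q / p - 1) * ballMax u G z ^ s * W z ^ q := by
              gcongr; exact hbd z
          _ = _ := by ring
    _ = (K ^ q) ^ s * H ^ (q / p - 1) * ∫⁻ z, ballMax u G z ^ s ∂u := by
        have hWB : Measurable fun z => W z ^ q * ballMax u G z ^ s := (hW.pow_const _).mul hBm
        rw [lintegral_const_mul _ hWB]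
        conv_rhs => rw [hu_def, lintegral_withDensity_eq_lintegral_mul _ (hW.pow_const _) hBm]
        rfl
    _ ≤ (K ^ q) ^ s * H ^ (q / p - 1) * (C₁ * (C₂ * H)) := by
        gcongr
        refine (hM₁ G hGm).trans ?_
        gcongr
        rw [hGs, ← hHσ]
        exact hM₂ h hhm
    _ = (K ^ q) ^ s * C₁ * C₂ * (H ^ (q / p - 1) * H) := by ring
    _ = _ := by
        congr 1
        nth_rw 2 [← ENNReal.rpow_one H]
        rw [← ENNReal.rpow_add_of_nonneg _ _ (by rw [sub_nonneg, one_le_div hp0]; exact hpq.le)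
          zero_le_one]
        congr 1; ring

end Fractional

/-- Weighted estimate for the fractional maximal operator: for
`0 < α < Q`, `1 < p < Q/α`, `1/q = 1/p − α/Q` and `ω ∈ A_{p,q}`,
`(∫ (M_α f)^q ω^q)^{1/q} ≤ C (∫ |f|^p ω^p)^{1/p}`. -/
theorem fracMax_weighted (n : ℕ) (α p q : ℝ) (hα0 : 0 < α) (hαQ : α < Q n)
    (hp1 : 1 < p) (hpQ : p < Q n / α) (hq : 1/q = 1/p - α / Q n)
    (ω : Hei n → ℝ) (hw : IsApq p q ω) :
    ∃ C > (0:ℝ), ∀ f : Hei n → ℝ, Measurable f →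
      (∫⁻ z, fracMax α f z ^ q * ENNReal.ofReal (ω z) ^ q) ^ (1/q) ≤
        ENNReal.ofReal C *
          (∫⁻ z, ENNReal.ofReal |f z| ^ p * ENNReal.ofReal (ω z) ^ p) ^ (1/p) := by
  obtain ⟨⟨hωm, hωpos, -⟩, K, -, hA⟩ := hw
  have hQ0 : 0 < Q n := hα0.trans hαQ
  have hp0 : 0 < p := by linarith
  have hαQ' : 0 < α / Q n := div_pos hα0 hQ0
  have hq0 : 0 < q := by
    rw [← one_div_pos, hq, sub_pos, div_lt_div_iff₀ hQ0 hp0, one_mul, mul_comm]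
    exact (lt_div_iff₀ hα0).1 hpQ
  have hpq : p < q := by
    rw [← one_div_lt_one_div hq0 hp0]
    linarith
  have hconj : p.HolderConjugate (conjExp p) := Real.HolderConjugate.conjExponent hp1
  have hsum : 1/p + 1/conjExp p = 1 := by simpa using hconj.inv_add_inv_eq_one
  have hW : Measurable fun z => ENNReal.ofReal (ω z) := hωm.ennreal_ofReal
  have hwInt (e : ℝ) (z : Hei n) (δ : ℝ) : wInt (fun z => ω z ^ e) (kball z δ) =
      volume.withDensity (fun z => ENNReal.ofReal (ω z) ^ e) (kball z δ) := by
    rw [withDensity_apply _ (isOpen_kball z δ).measurableSet]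
    refine lintegral_congr_ae ((ae_restrict_of_ae hωpos).mono fun z hz => ?_)
    exact (ENNReal.ofReal_rpow_of_pos hz).symm
  simp only [hwInt] at hA
  obtain ⟨C, hC, h⟩ := lintegral_fracMax_rpow_le (α := α) hW
    (hωpos.mono fun z hz => by simpa using hz) (Filter.Eventually.of_forall fun z => ofReal_ne_top)
    hconj hpq (by linarith) ofReal_ne_top hA
  have hC' : C ^ (1/q) ≠ ∞ := ENNReal.rpow_ne_top_of_nonneg (by positivity) hC
  refine ⟨(C ^ (1/q)).toReal + 1, by positivity, fun f hf => ?_⟩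
  refine (ENNReal.rpow_le_rpow (h f hf) (by positivity : 0 ≤ 1/q)).trans ?_
  rw [ENNReal.mul_rpow_of_nonneg _ _ (by positivity), ← ENNReal.rpow_mul,
    show q / p * (1/q) = 1/p by field_simp]
  gcongr
  exact (ENNReal.ofReal_toReal hC').symm.trans_le (ENNReal.ofReal_le_ofReal (by linarith))

end Heisenberg
end
end

section
/- Let p(·) : ℍⁿ → (0,∞) be an exponent function with 0 < p₋ ≤ p₊ < ∞ and let {B_j} be a family of ρ-balls with the bounded intersection property. If 0 < p_* < p̲ := min{p₋,1}, then for any sequence of nonnegative numbers {λ_j}, ‖(Σ_j (λ_j χ_{B_j}/‖χ_{B_j}‖_{L^{p(·)}})^{p_*})^{1/p_*}‖_{L^{p(·)}} ≈ ‖(Σ_j (λ_j χ_{B_j}/‖χ_{B_j}‖_{L^{p(·)}})^{p̲})^{1/p̲}‖_{L^{p(·)}}, with implicit constants independent of {λ_j}. -/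
open MeasureTheory ENNReal Real Set

noncomputable section

namespace Heisenberg

variable (n : ℕ)

variable {n}

/-- The `ℓ^q` power sum is dominated by the `ℓ^r` one for `r ≤ q`. -/
theorem sum_rpow_le_sum_rpow {ι : Type*} (s : Finset ι) (f : ι → ℝ≥0∞) {r q : ℝ}
    (hr : 0 < r) (hrq : r ≤ q) :
    (∑ i ∈ s, f i ^ q) ^ (1 / q) ≤ (∑ i ∈ s, f i ^ r) ^ (1 / r) := by
  classical
  have hq : 0 < q := hr.trans_le hrq
  have key : ∑ i ∈ s, f i ^ q ≤ (∑ i ∈ s, f i ^ r) ^ (q / r) := by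
    induction s using Finset.induction_on with
    | empty => simp
    | insert a s ha ih =>
      rw [Finset.sum_insert ha, Finset.sum_insert ha]
      calc f a ^ q + ∑ i ∈ s, f i ^ q
          ≤ (f a ^ r) ^ (q / r) + (∑ i ∈ s, f i ^ r) ^ (q / r) := by
            gcongr
            rw [← ENNReal.rpow_mul, mul_div_cancel₀ _ hr.ne']
        _ ≤ _ := ENNReal.add_rpow_le_rpow_add _ _ ((one_le_div hr).2 hrq)
  calc (∑ i ∈ s, f i ^ q) ^ (1 / q)
      ≤ ((∑ i ∈ s, f i ^ r) ^ (q / r)) ^ (1 / q) := by gcongr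
    _ = _ := by rw [← ENNReal.rpow_mul]; congr 1; field_simp

/-- On an index set of at most `K` elements the `ℓ^r` power sum is dominated, up to a constant,
by the `ℓ^q` one for `r ≤ q`. -/
theorem sum_rpow_le_const_mul_sum_rpow {ι : Type*} (s : Finset ι) (f : ι → ℝ≥0∞) {r q : ℝ}
    (hr : 0 < r) (hrq : r ≤ q) {K : ℕ} (hK : s.card ≤ K) :
    (∑ i ∈ s, f i ^ r) ^ (1 / r) ≤
      (K : ℝ≥0∞) ^ ((q / r - 1) * (1 / q)) * (∑ i ∈ s, f i ^ q) ^ (1 / q) := by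
  have hq : 0 < q := hr.trans_le hrq
  have h1 : 1 ≤ q / r := (one_le_div hr).2 hrq
  have key := ENNReal.rpow_sum_le_const_mul_sum_rpow s (fun i => f i ^ r) h1
  simp only [← ENNReal.rpow_mul, mul_div_cancel₀ _ hr.ne'] at key
  calc (∑ i ∈ s, f i ^ r) ^ (1 / r) = ((∑ i ∈ s, f i ^ r) ^ (q / r)) ^ (1 / q) := by
        rw [← ENNReal.rpow_mul]; congr 1; field_simp
    _ ≤ ((s.card : ℝ≥0∞) ^ (q / r - 1) * ∑ i ∈ s, f i ^ q) ^ (1 / q) := by gcongr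
    _ ≤ ((K : ℝ≥0∞) ^ (q / r - 1) * ∑ i ∈ s, f i ^ q) ^ (1 / q) := by
        have : 0 ≤ q / r - 1 := sub_nonneg.2 h1
        gcongr
    _ = _ := by rw [ENNReal.mul_rpow_of_nonneg _ _ (by positivity), ← ENNReal.rpow_mul]

/-- An exponent with positive essential infimum is positive almost everywhere. -/
theorem ae_pos_of_pminus_pos {p : Hei n → ℝ} (h0 : 0 < pminus p) :
    ∀ᵐ z ∂(volume : Measure (Hei n)), 0 < p z := by
  rw [pminus, essInf_eq_sSup] at h0
  obtain ⟨a, ha, ha0⟩ : ∃ a ∈ {a | volume {z | p z < a} = 0}, 0 < a := by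
    by_contra! h
    exact h0.not_ge (Real.sSup_nonpos h)
  have ha' : ∀ᵐ z ∂(volume : Measure (Hei n)), ¬ p z < a := measure_eq_zero_iff_ae_notMem.1 ha
  filter_upwards [ha'] with z hz
  exact ha0.trans_le (not_lt.1 hz)

theorem modular_le_modular {p : Hei n → ℝ} (hp : ∀ᵐ z ∂(volume : Measure (Hei n)), 0 < p z)
    {F G : Hei n → ℝ≥0∞} {C : ℝ} (hC : 0 < C) (hFG : ∀ z, F z ≤ ENNReal.ofReal C * G z)
    (μ : ℝ) : modular p F (C * μ) ≤ modular p G μ := by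
  refine lintegral_mono_ae ?_
  filter_upwards [hp] with z hz
  refine ENNReal.rpow_le_rpow ?_ hz.le
  rw [ENNReal.ofReal_mul hC.le]
  calc F z / (ENNReal.ofReal C * ENNReal.ofReal μ)
      ≤ ENNReal.ofReal C * G z / (ENNReal.ofReal C * ENNReal.ofReal μ) := by gcongr; exact hFG z
    _ = _ := ENNReal.mul_div_mul_left _ _ (by simpa using hC) ENNReal.ofReal_ne_top

/-- Monotonicity of the Luxemburg norm. The bound of `G` by `F` covers the case where the
infimum defining the norm of `G` is taken over the empty set. -/
theorem vnormE_le_mul {p : Hei n → ℝ} (hp : ∀ᵐ z ∂(volume : Measure (Hei n)), 0 < p z)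
    {F G : Hei n → ℝ≥0∞} {C D : ℝ} (hC : 0 < C) (hFG : ∀ z, F z ≤ ENNReal.ofReal C * G z)
    (hD : 0 < D) (hGF : ∀ z, G z ≤ ENNReal.ofReal D * F z) :
    vnormE p F ≤ C * vnormE p G := by
  unfold vnormE
  rcases {μ : ℝ | 0 < μ ∧ modular p G μ ≤ 1}.eq_empty_or_nonempty with hG | hG
  · have hF : {μ : ℝ | 0 < μ ∧ modular p F μ ≤ 1} = ∅ := by
      refine eq_empty_of_forall_notMem fun μ hμ => ?_
      exact hG.subset ⟨mul_pos hD hμ.1, (modular_le_modular hp hD hGF μ).trans hμ.2⟩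
    simp [hF, hG]
  · rw [← div_le_iff₀' hC]
    refine le_csInf hG fun μ hμ => ?_
    rw [div_le_iff₀' hC]
    exact csInf_le ⟨0, fun x hx => hx.1.le⟩
      ⟨mul_pos hC hμ.1, (modular_le_modular hp hC hFG μ).trans hμ.2⟩

/-- In a family with the bounded intersection property, every point lies in finitely many, at
most `K`, of the sets. -/
theorem BoundedIntersection.exists_finset {B : ℕ → Set (Hei n)} (hB : BoundedIntersection B) :
    ∃ K : ℕ, 0 < K ∧ ∀ z, ∃ s : Finset ℕ, s.card ≤ K ∧ ∀ j ∉ s, z ∉ B j := by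
  obtain ⟨K, hK⟩ := hB
  refine ⟨K + 1, K.succ_pos, fun z => ?_⟩
  have hfin : {j | z ∈ B j}.Finite := by
    by_contra hinf
    obtain ⟨t, ht, htc⟩ := Set.Infinite.exists_subset_card_eq hinf (K + 1)
    exact absurd (hK z t fun j hj => ht hj) (by omega)
  refine ⟨hfin.toFinset, (hK z _ fun j hj => by simpa using hj).trans K.le_succ, ?_⟩
  simp

/-- For an exponent `p(·)` with `0 < p₋ ≤ p₊ < ∞`, a family of balls
`{B_j}` with the bounded intersection property and `0 < p_* < p̲`, the `ℓ^{p_*}`-based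
quantity is equivalent to `A({λ_j},{B_j},p(·))`, uniformly in `{λ_j}`. -/
theorem acal_pstar_equiv (n : ℕ) (p : Hei n → ℝ) (hmeas : Measurable p)
    (h0 : 0 < pminus p) (hbd : ∃ M : ℝ, ∀ᵐ z ∂(volume : Measure (Hei n)), p z ≤ M)
    (c : ℕ → Hei n) (d : ℕ → ℝ) (hd : ∀ j, 0 < d j)
    (hbip : BoundedIntersection fun j => kball (c j) (d j))
    (ps : ℝ) (hps0 : 0 < ps) (hpsu : ps < punder p) :
    ∃ c₁ > (0:ℝ), ∃ c₂ > (0:ℝ), ∀ lam : ℕ → ℝ, (∀ j, 0 ≤ lam j) →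
      c₁ * Acal p lam c d ≤
        vnormE p (fun z => (∑' j,
          ((ENNReal.ofReal (lam j) / ENNReal.ofReal (chiNorm p (kball (c j) (d j)))) *
            chiE (kball (c j) (d j)) z) ^ ps) ^ (1/ps)) ∧
      vnormE p (fun z => (∑' j,
          ((ENNReal.ofReal (lam j) / ENNReal.ofReal (chiNorm p (kball (c j) (d j)))) *
            chiE (kball (c j) (d j)) z) ^ ps) ^ (1/ps)) ≤
        c₂ * Acal p lam c d := by
  obtain ⟨K, hK0, hK⟩ := hbip.exists_finset
  have hp := ae_pos_of_pminus_pos h0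
  have hu : 0 < punder p := hps0.trans hpsu
  set a : ℕ → Hei n → ℝ≥0∞ → ℝ≥0∞ := fun j z t =>
    t / ENNReal.ofReal (chiNorm p (kball (c j) (d j))) * chiE (kball (c j) (d j)) z with ha
  set C : ℝ := (K : ℝ) ^ ((punder p / ps - 1) * (1 / punder p)) with hCdef
  have hC : 0 < C := Real.rpow_pos_of_pos (by exact_mod_cast hK0) _
  have hCE : ENNReal.ofReal C = (K : ℝ≥0∞) ^ ((punder p / ps - 1) * (1 / punder p)) := by
    rw [hCdef, ← ENNReal.ofReal_rpow_of_pos (by exact_mod_cast hK0), ENNReal.ofReal_natCast]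
  have tsum_eq (lam : ℕ → ℝ) (z : Hei n) (s : Finset ℕ)
      (hs : ∀ j ∉ s, z ∉ kball (c j) (d j)) (q : ℝ) (hq : 0 < q) :
      ∑' j, a j z (ENNReal.ofReal (lam j)) ^ q =
        ∑ j ∈ s, a j z (ENNReal.ofReal (lam j)) ^ q :=
    tsum_eq_sum fun j hj => by simp [ha, chiE, hs j hj, hq]
  have hle (lam : ℕ → ℝ) (z : Hei n) :
      (∑' j, a j z (ENNReal.ofReal (lam j)) ^ punder p) ^ (1 / punder p) ≤
        ENNReal.ofReal 1 * (∑' j, a j z (ENNReal.ofReal (lam j)) ^ ps) ^ (1 / ps) := by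
    obtain ⟨s, -, hs⟩ := hK z
    rw [tsum_eq lam z s hs _ hu, tsum_eq lam z s hs _ hps0, ENNReal.ofReal_one, one_mul]
    exact sum_rpow_le_sum_rpow s _ hps0 hpsu.le
  have hge (lam : ℕ → ℝ) (z : Hei n) :
      (∑' j, a j z (ENNReal.ofReal (lam j)) ^ ps) ^ (1 / ps) ≤ ENNReal.ofReal C *
        (∑' j, a j z (ENNReal.ofReal (lam j)) ^ punder p) ^ (1 / punder p) := by
    obtain ⟨s, hsK, hs⟩ := hK z
    rw [tsum_eq lam z s hs _ hu, tsum_eq lam z s hs _ hps0, hCE]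
    exact sum_rpow_le_const_mul_sum_rpow s _ hps0 hpsu.le hsK
  refine ⟨1, one_pos, C, hC, fun lam _ => ⟨?_, ?_⟩⟩
  · rw [one_mul, ← one_mul (vnormE p _)]
    exact vnormE_le_mul hp one_pos (hle lam) hC (hge lam)
  · exact vnormE_le_mul hp hC (hge lam) one_pos (hle lam)

end Heisenberg
end
end
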